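/- arXiv:0904.1162 — 3 statements merged into one kernel-verified Lean document; each statement's English description precedes it below -/
import Mathlib

section
/- Let p > 3 be a prime. Then the sum over all integers 0 < i < j < k < p of (i/3)·(-1)^i/(ijk) is congruent to 0 modulo p, where the sum is computed in ℤ/pℤ with 1/(ijk) denoting the product of the inverses of i, j, k modulo p. -/
open Polynomial in
/-- A polynomial of degree less than the characteristic whose derivative vanishes is constant. -/
theorem Polynomial.eq_C_of_derivative_eq_zero_of_natDegree_lt {p : ℕ} [Fact p.Prime]
    {f : (ZMod p)[X]} (hf : derivative f = 0) (hdeg : f.natDegree < p) :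
    f = C (f.coeff 0) := by
  ext n
  rcases n with _ | n
  · simp
  rw [coeff_C_succ]
  by_cases hn : n + 1 < p
  · have h := congrArg (fun g => coeff g n) hf
    simp only [coeff_derivative, coeff_zero] at h
    refine (mul_eq_zero.mp h).resolve_right fun h0 => ?_
    have h1 : ((n + 1 : ℕ) : ZMod p) = 0 := by exact_mod_cast h0
    rw [ZMod.natCast_eq_zero_iff] at h1
    exact absurd (Nat.le_of_dvd n.succ_pos h1) (by omega)
  · exact coeff_eq_zero_of_natDegree_lt (by omega)

/-- Interchange of summation over the pairs `0 < i < j < n`. -/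
theorem Finset.sum_Ioo_Ioo_comm {M : Type*} [AddCommMonoid M] (n : ℕ) (f : ℕ → ℕ → M) :
    ∑ i ∈ Ioo 0 n, ∑ j ∈ Ioo i n, f i j = ∑ j ∈ Ioo 0 n, ∑ i ∈ Ioo 0 j, f i j := by
  refine Finset.sum_comm' fun i j => ?_
  simp only [mem_Ioo]
  omega

theorem Finset.sum_Ioo_zero_sub {M : Type*} [AddCommGroup M] (f : ℕ → M) {n : ℕ} (hn : 0 < n) :
    ∑ i ∈ Ioo 0 n, (f (i + 1) - f i) = f n - f 1 := by
  induction n, hn using Nat.le_induction with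
  | base => simp [show Ioo 0 1 = ∅ from rfl]
  | succ n hn ih =>
    have h : Ioo 0 (n + 1) = insert n (Ioo 0 n) := by
      ext i
      simp only [mem_Ioo, mem_insert]
      omega
    rw [h, sum_insert (by simp), ih]
    abel

theorem Finset.sq_sum_Ioo {R : Type*} [CommRing R] (n : ℕ) (a : ℕ → R) :
    (∑ i ∈ Ioo 0 n, a i) ^ 2 =
      2 * ∑ i ∈ Ioo 0 n, ∑ j ∈ Ioo i n, a j * a i + ∑ i ∈ Ioo 0 n, a i ^ 2 := by
  have h : ∀ i ∈ Ioo 0 n, ∑ j ∈ Ioo 0 n, a i * a j =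
      ∑ j ∈ Ioo i n, a j * a i + a i ^ 2 + ∑ j ∈ Ioo 0 i, a i * a j := by
    intro i hi
    rw [mem_Ioo] at hi
    have hs : Ioo 0 n = insert i (Ioo i n ∪ Ioo 0 i) := by
      ext j
      simp only [mem_Ioo, mem_insert, mem_union]
      omega
    rw [hs, sum_insert (by simp), sum_union]
    · simp only [mul_comm (a i)]
      ring
    · rw [disjoint_left]
      intro j
      simp only [mem_Ioo]
      omega
  rw [sq, sum_mul_sum, sum_congr rfl h, sum_add_distrib, sum_add_distrib,
    ← sum_Ioo_Ioo_comm n fun i j => a j * a i]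
  ring

theorem ZMod.sum_Ioo_natCast {p : ℕ} [Fact p.Prime] {M : Type*} [AddCommMonoid M]
    (f : ZMod p → M) (hf : f 0 = 0) :
    ∑ i ∈ Finset.Ioo 0 p, f i = ∑ x, f x := by
  have hp : 0 < p := (Fact.out : p.Prime).pos
  have h : ∑ i ∈ Finset.range p, f i = ∑ x, f x := by
    refine Finset.sum_nbij' (fun i => (i : ZMod p)) ZMod.val ?_ ?_ ?_ ?_ ?_
    · simp
    · exact fun x _ => Finset.mem_range.mpr (ZMod.val_lt x)
    · exact fun i hi => ZMod.val_cast_of_lt (Finset.mem_range.mp hi)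
    · exact fun x _ => ZMod.natCast_zmod_val x
    · simp
  rw [← h]
  have hs : Finset.range p = insert 0 (Finset.Ioo 0 p) := by
    ext i
    simp only [Finset.mem_range, Finset.mem_insert, Finset.mem_Ioo]
    omega
  rw [hs, Finset.sum_insert (by simp)]
  simp [hf]

theorem ZMod.sum_Ioo_inv_pow {p m : ℕ} [Fact p.Prime] (hm : m ≠ 0) (hmp : m < p - 1) :
    ∑ i ∈ Finset.Ioo 0 p, ((i : ZMod p)⁻¹) ^ m = 0 := by
  rw [ZMod.sum_Ioo_natCast (fun x : ZMod p => x⁻¹ ^ m) (by simp [hm]),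
    inv_involutive.bijective.sum_comp fun x : ZMod p => x ^ m]
  exact FiniteField.sum_pow_lt_card_sub_one (ZMod p) m (by rwa [ZMod.card])

theorem ZMod.sum_Ioo_inv {p : ℕ} [Fact p.Prime] (hp : 3 < p) :
    ∑ i ∈ Finset.Ioo 0 p, (i : ZMod p)⁻¹ = 0 := by
  simpa using ZMod.sum_Ioo_inv_pow (p := p) one_ne_zero (by omega)

theorem ZMod.two_ne_zero_of_three_lt {p : ℕ} [Fact p.Prime] (hp : 3 < p) : (2 : ZMod p) ≠ 0 := by
  intro h
  have h' : ((2 : ℕ) : ZMod p) = 0 := by exact_mod_cast h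
  rw [ZMod.natCast_eq_zero_iff] at h'
  exact absurd (Nat.le_of_dvd two_pos h') (by omega)

theorem ZMod.sum_Ioo_sum_Ioo_inv {p : ℕ} [Fact p.Prime] (hp : 3 < p) :
    ∑ i ∈ Finset.Ioo 0 p, (∑ j ∈ Finset.Ioo i p, (j : ZMod p)⁻¹) * (i : ZMod p)⁻¹ = 0 := by
  have h := Finset.sq_sum_Ioo p fun i => (i : ZMod p)⁻¹
  rw [ZMod.sum_Ioo_inv hp, ZMod.sum_Ioo_inv_pow two_ne_zero (by omega)] at h
  simp only [← Finset.sum_mul] at h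
  simpa [ZMod.two_ne_zero_of_three_lt hp] using h.symm

namespace TruncatedPolylog

open Polynomial Finset

/-- The polynomial `∑_{0 < i < p} w(i) xⁱ / i` over `ℤ/pℤ`. -/
noncomputable def weightedLog (p : ℕ) (w : ℕ → ZMod p) : (ZMod p)[X] :=
  ∑ i ∈ Ioo 0 p, C (w i * (i : ZMod p)⁻¹) * X ^ i

/-- The weights `i ↦ ∑_{i < j < p} w(j) / j`. -/
def tailWeight (p : ℕ) (w : ℕ → ZMod p) (i : ℕ) : ZMod p :=
  ∑ j ∈ Ioo i p, w j * (j : ZMod p)⁻¹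

variable {p : ℕ}

theorem natDegree_weightedLog_lt (hp : 0 < p) (w : ℕ → ZMod p) :
    (weightedLog p w).natDegree < p := by
  refine Nat.lt_of_le_pred hp (natDegree_sum_le_of_forall_le _ _ fun i hi => ?_)
  exact (natDegree_C_mul_X_pow_le _ _).trans (Nat.le_pred_of_lt (mem_Ioo.mp hi).2)

theorem natDegree_weightedLog_comp_lt (hp : 0 < p) (w : ℕ → ZMod p) :
    ((weightedLog p w).comp (1 - X)).natDegree < p := by
  refine lt_of_le_of_lt (natDegree_comp_le.trans ?_) (natDegree_weightedLog_lt hp w)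
  have h : (1 - X : (ZMod p)[X]).natDegree ≤ 1 := by compute_degree
  exact (Nat.mul_le_mul_left _ h).trans (mul_one _).le

theorem X_mul_derivative_weightedLog [Fact p.Prime] (w : ℕ → ZMod p) :
    X * derivative (weightedLog p w) = ∑ i ∈ Ioo 0 p, C (w i) * X ^ i := by
  rw [weightedLog, derivative_sum, mul_sum]
  refine sum_congr rfl fun i hi => ?_
  rw [mem_Ioo] at hi
  have hi0 : (i : ZMod p) ≠ 0 := by
    rw [Ne, ZMod.natCast_eq_zero_iff]
    exact fun h => absurd (Nat.le_of_dvd hi.1 h) (by omega)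
  obtain ⟨k, rfl⟩ : ∃ k, i = k + 1 := ⟨i - 1, by omega⟩
  rw [derivative_C_mul_X_pow, inv_mul_cancel_right₀ hi0, Nat.add_sub_cancel, pow_succ]
  ring

theorem X_mul_derivative_weightedLog_one [Fact p.Prime] :
    X * (X - 1) * derivative (weightedLog p fun _ => 1) = X ^ p - X := by
  have hp : 0 < p := (Fact.out : p.Prime).pos
  rw [mul_right_comm, X_mul_derivative_weightedLog, sum_mul]
  have h := sum_Ioo_zero_sub (fun i => (X : (ZMod p)[X]) ^ i) hp
  rw [pow_one] at h
  rw [← h]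
  refine sum_congr rfl fun i _ => ?_
  rw [map_one]
  ring

theorem X_mul_derivative_weightedLog_tailWeight [Fact p.Prime] {w : ℕ → ZMod p}
    (hw : ∑ i ∈ Ioo 0 p, w i * (i : ZMod p)⁻¹ = 0) :
    X * (X - 1) * derivative (weightedLog p (tailWeight p w)) = weightedLog p w := by
  have h : ∀ j ∈ Ioo 0 p, ∑ i ∈ Ioo 0 j, C (w j * (j : ZMod p)⁻¹) * (X ^ (i + 1) - X ^ i) =
      C (w j * (j : ZMod p)⁻¹) * X ^ j - C (w j * (j : ZMod p)⁻¹) * X := by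
    intro j hj
    rw [← mul_sum, sum_Ioo_zero_sub (fun i => (X : (ZMod p)[X]) ^ i) (mem_Ioo.mp hj).1]
    ring
  calc X * (X - 1) * derivative (weightedLog p (tailWeight p w))
      = ∑ i ∈ Ioo 0 p, ∑ j ∈ Ioo i p, C (w j * (j : ZMod p)⁻¹) * (X ^ (i + 1) - X ^ i) := by
        rw [mul_right_comm, X_mul_derivative_weightedLog, sum_mul]
        refine sum_congr rfl fun i _ => ?_
        rw [tailWeight, map_sum, ← sum_mul]
        ring
    _ = weightedLog p w := by
        rw [sum_Ioo_Ioo_comm, sum_congr rfl h, sum_sub_distrib, ← sum_mul, ← map_sum, hw]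
        simp [weightedLog]

/-- The operator `x (x - 1) d/dx` changes sign under the substitution `x ↦ 1 - x`. -/
theorem X_mul_derivative_comp [Fact p.Prime] {f g : (ZMod p)[X]}
    (h : X * (X - 1) * derivative f = g) :
    X * (X - 1) * derivative (f.comp (1 - X)) = -g.comp (1 - X) := by
  rw [← h, derivative_comp]
  simp only [mul_comp, sub_comp, X_comp, one_comp, derivative_sub, derivative_one, derivative_X]
  ring

theorem derivative_eq_zero_of_X_mul [Fact p.Prime] {f : (ZMod p)[X]}
    (h : X * (X - 1) * derivative f = 0) : derivative f = 0 := by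
  have h1 : (X - 1 : (ZMod p)[X]) ≠ 0 := by
    simpa using X_sub_C_ne_zero (1 : ZMod p)
  exact (mul_eq_zero.mp h).resolve_left (mul_ne_zero X_ne_zero h1)

/-- A weighted logarithm is symmetric as soon as its image under `x (x - 1) d/dx` is
antisymmetric. -/
theorem weightedLog_symm [Fact p.Prime] (hp : 3 < p) {w : ℕ → ZMod p} {g : (ZMod p)[X]}
    (h : X * (X - 1) * derivative (weightedLog p w) = g) (hg : g.comp (1 - X) = -g) :
    (weightedLog p w).comp (1 - X) = weightedLog p w := by
  set f := weightedLog p w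
  have hd : derivative (f.comp (1 - X) - f) = 0 := by
    apply derivative_eq_zero_of_X_mul
    rw [derivative_sub, mul_sub, X_mul_derivative_comp h, h, hg]
    ring
  have hc := eq_C_of_derivative_eq_zero_of_natDegree_lt hd
    ((natDegree_sub_le _ _).trans_lt (max_lt (natDegree_weightedLog_comp_lt (by omega) w)
      (natDegree_weightedLog_lt (by omega) w)))
  set c := (f.comp (1 - X) - f).coeff 0
  have h0 := congrArg (eval 0) hc
  have h1 := congrArg (eval 1) hc
  simp only [eval_sub, eval_comp, eval_one, eval_X, eval_C, sub_zero, sub_self] at h0 h1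
  have hc0 : c = 0 := by
    refine (mul_eq_zero.mp (?_ : 2 * c = 0)).resolve_left (ZMod.two_ne_zero_of_three_lt hp)
    linear_combination -h0 - h1
  rw [hc0, map_zero] at hc
  exact sub_eq_zero.mp hc

/-- A weighted logarithm vanishing at `1` is antisymmetric as soon as its image under
`x (x - 1) d/dx` is symmetric. -/
theorem weightedLog_antisymm [Fact p.Prime] {w : ℕ → ZMod p} {g : (ZMod p)[X]}
    (h : X * (X - 1) * derivative (weightedLog p w) = g) (hg : g.comp (1 - X) = g)
    (hw : ∑ i ∈ Ioo 0 p, w i * (i : ZMod p)⁻¹ = 0) :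
    (weightedLog p w).comp (1 - X) = -weightedLog p w := by
  have hp : 0 < p := (Fact.out : p.Prime).pos
  set f := weightedLog p w with hf
  have hd : derivative (f.comp (1 - X) + f) = 0 := by
    apply derivative_eq_zero_of_X_mul
    rw [derivative_add, mul_add, X_mul_derivative_comp h, h, hg]
    ring
  have hc := eq_C_of_derivative_eq_zero_of_natDegree_lt hd
    ((natDegree_add_le _ _).trans_lt (max_lt (natDegree_weightedLog_comp_lt hp w)
      (natDegree_weightedLog_lt hp w)))
  have h0 : eval 0 f = 0 := by
    rw [hf, weightedLog, eval_finsetSum]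
    refine sum_eq_zero fun i hi => ?_
    simp [(mem_Ioo.mp hi).1.ne']
  have h1 : eval 1 f = 0 := by
    rw [hf, weightedLog, eval_finsetSum, ← hw]
    simp
  have hcoeff : (f.comp (1 - X) + f).coeff 0 = 0 := by
    rw [coeff_zero_eq_eval_zero]
    simp [eval_comp, h0, h1]
  rw [hcoeff, map_zero] at hc
  exact eq_neg_of_add_eq_zero_left hc

theorem weightedLog_triple_symm [Fact p.Prime] (hp : 3 < p) :
    (weightedLog p (tailWeight p (tailWeight p fun _ => 1))).comp (1 - X) =
      weightedLog p (tailWeight p (tailWeight p fun _ => 1)) := by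
  have w1 : ∑ i ∈ Ioo 0 p, (1 : ZMod p) * (i : ZMod p)⁻¹ = 0 := by
    simpa using ZMod.sum_Ioo_inv hp
  have w2 : ∑ i ∈ Ioo 0 p, tailWeight p (fun _ => 1) i * (i : ZMod p)⁻¹ = 0 := by
    simpa [tailWeight] using ZMod.sum_Ioo_sum_Ioo_inv hp
  refine weightedLog_symm hp (X_mul_derivative_weightedLog_tailWeight w2) ?_
  refine weightedLog_antisymm (X_mul_derivative_weightedLog_tailWeight w1) ?_ w2
  refine weightedLog_symm hp X_mul_derivative_weightedLog_one ?_
  simp only [sub_comp, pow_comp, X_comp, sub_pow_char, one_pow]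
  ring

end TruncatedPolylog

/-- The powers of a primitive sixth root of unity `x` and of its conjugate `1 - x` differ by
`-(i/3) (-1)ⁱ (2 x - 1)`. -/
theorem pow_sub_one_sub_pow_of_sq_sub_self_add_one {R : Type*} [CommRing R] {x : R}
    (hx : x ^ 2 - x + 1 = 0) (i : ℕ) :
    x ^ i - (1 - x) ^ i =
      -((if i % 3 = 1 then (1 : R) else if i % 3 = 2 then -1 else 0) * (-1) ^ i) * (2 * x - 1) := by
  have h3 : x ^ 3 = -1 := by linear_combination (x + 1) * hx
  have h3' : (1 - x) ^ 3 = -1 := by linear_combination (2 - x) * hx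
  obtain ⟨q, r, hr, rfl⟩ : ∃ q r, r < 3 ∧ i = 3 * q + r :=
    ⟨i / 3, i % 3, Nat.mod_lt _ (by norm_num), (Nat.div_add_mod i 3).symm⟩
  have hs : ((-1 : R)) ^ (3 * q) = (-1) ^ q := by rw [pow_mul]; norm_num
  rw [pow_add, pow_add, pow_add, pow_mul, pow_mul, h3, h3', hs, Nat.mul_add_mod]
  interval_cases r
  · simp
  · simp
    ring
  · simp
    ring

open TruncatedPolylog in
/-- Let `p > 3` be a prime. Then
`∑_{0<i<j<k<p} (i/3)·(-1)^i/(ijk) ≡ 0 (mod p)`, computed in `ℤ/pℤ`,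
where `(i/3)` is `1` if `i ≡ 1 (mod 3)`, `-1` if `i ≡ 2 (mod 3)`, `0` if `3 ∣ i`. -/
theorem curious_congruence_triple (p : ℕ) (hp : p.Prime) (hp3 : 3 < p) :
    ∑ i ∈ Finset.Ioo 0 p, ∑ j ∈ Finset.Ioo i p, ∑ k ∈ Finset.Ioo j p,
      (if i % 3 = 1 then (1 : ZMod p) else if i % 3 = 2 then -1 else 0) *
        (-1) ^ i * ((i : ZMod p)⁻¹ * (j : ZMod p)⁻¹ * (k : ZMod p)⁻¹) = 0 := by
  have : Fact p.Prime := ⟨hp⟩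
  let L := AlgebraicClosure (ZMod p)
  let φ := algebraMap (ZMod p) L
  obtain ⟨x, hx⟩ : ∃ x : L, x ^ 2 - x + 1 = 0 := by
    have hdeg : (Polynomial.X ^ 2 - Polynomial.X + 1 : Polynomial L).degree = 2 := by
      compute_degree!
    obtain ⟨x, hx⟩ := IsAlgClosed.exists_root (k := L)
      (Polynomial.X ^ 2 - Polynomial.X + 1) (by rw [hdeg]; norm_num)
    exact ⟨x, by simpa using hx⟩
  have h3 : (3 : L) ≠ 0 := by
    intro h
    have h' : φ 3 = 0 := by rw [map_ofNat, h]
    have h'' : ((3 : ℕ) : ZMod p) = 0 := by exact_mod_cast (map_eq_zero φ).mp h'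
    rw [ZMod.natCast_eq_zero_iff] at h''
    exact absurd (Nat.le_of_dvd (by norm_num) h'') (by omega)
  have hx2 : 2 * x - 1 ≠ 0 := by
    intro h
    apply h3
    linear_combination 4 * hx - (2 * x - 1) * h
  let w := tailWeight p (tailWeight p fun _ => 1)
  have hsymm := congrArg (Polynomial.eval₂ φ x) (weightedLog_triple_symm hp3)
  rw [Polynomial.eval₂_comp, weightedLog, Polynomial.eval₂_finsetSum,
    Polynomial.eval₂_finsetSum, eq_comm, ← sub_eq_zero, ← Finset.sum_sub_distrib] at hsymm
  let s : ℕ → ZMod p := fun i =>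
    (if i % 3 = 1 then (1 : ZMod p) else if i % 3 = 2 then -1 else 0) * (-1) ^ i
  have hsum : φ (∑ i ∈ Finset.Ioo 0 p, s i * (w i * (i : ZMod p)⁻¹)) * (2 * x - 1) = 0 := by
    rw [← neg_eq_zero, ← hsymm, map_sum, Finset.sum_mul, ← Finset.sum_neg_distrib]
    refine Finset.sum_congr rfl fun i _ => ?_
    have hi := pow_sub_one_sub_pow_of_sq_sub_self_add_one hx i
    have hs : φ (s i) =
        (if i % 3 = 1 then (1 : L) else if i % 3 = 2 then -1 else 0) * (-1) ^ i := by
      simp only [s, map_mul, map_pow, map_neg, map_one, apply_ite φ, map_zero]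
    rw [← hs] at hi
    simp only [Polynomial.eval₂_mul, Polynomial.eval₂_C, Polynomial.eval₂_pow, Polynomial.eval₂_X,
      Polynomial.eval₂_sub, Polynomial.eval₂_one]
    rw [map_mul φ (s i)]
    linear_combination -φ (w i * (i : ZMod p)⁻¹) * hi
  refine Eq.trans ?_ ((map_eq_zero φ).mp ((mul_eq_zero.mp hsum).resolve_right hx2))
  refine Finset.sum_congr rfl fun i _ => ?_
  simp only [w, s, tailWeight, Finset.sum_mul, Finset.mul_sum]
  refine Finset.sum_congr rfl fun j _ => Finset.sum_congr rfl fun k _ => ?_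
  ring
end

section
/- Let p > 3 be a prime. Then the sum in ℤ/pℤ of 1/(ijk) over all integers 0 < i < j < k < p with i ≡ 1 or 2 (mod 6) equals the sum in ℤ/pℤ of 1/(ijk) over all integers 0 < i < j < k < p with i ≡ 4 or 5 (mod 6). -/
section
open Polynomial Finset

/-- The polynomial `∑ (c i / i) X ^ i` over `0 < i < p`. -/
noncomputable def polylogPoly (p : ℕ) (c : ℕ → ZMod p) : (ZMod p)[X] :=
  ∑ i ∈ Ioo 0 p, C (c i * (i : ZMod p)⁻¹) * X ^ i

/-- The tail sum `∑ c j / j` over `i < j < p`. -/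
def harmonicTail (p : ℕ) (c : ℕ → ZMod p) (i : ℕ) : ZMod p :=
  ∑ j ∈ Finset.Ioo i p, c j * (j : ZMod p)⁻¹

theorem natCast_ne_zero_of_mem_Ioo {p i : ℕ} (h : i ∈ Ioo 0 p) : (i : ZMod p) ≠ 0 := by
  rw [mem_Ioo] at h
  rw [Ne, ZMod.natCast_eq_zero_iff]
  exact Nat.not_dvd_of_pos_of_lt h.1 h.2

theorem natDegree_polylogPoly_lt {p : ℕ} (hp : 0 < p) (c : ℕ → ZMod p) :
    (polylogPoly p c).natDegree < p := by
  suffices (polylogPoly p c).natDegree ≤ p - 1 by omega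
  refine natDegree_sum_le_of_forall_le _ _ fun i hi => ?_
  rw [mem_Ioo] at hi
  exact (natDegree_C_mul_X_pow_le _ _).trans (by omega)

theorem eval_zero_polylogPoly (p : ℕ) (c : ℕ → ZMod p) : (polylogPoly p c).eval 0 = 0 := by
  rw [polylogPoly, eval_finsetSum]
  refine sum_eq_zero fun i hi => ?_
  have : i ≠ 0 := (mem_Ioo.1 hi).1.ne'
  simp [this]

theorem eval_one_polylogPoly (p : ℕ) (c : ℕ → ZMod p) :
    (polylogPoly p c).eval 1 = harmonicTail p c 0 := by
  simp [polylogPoly, harmonicTail, eval_finsetSum]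

variable {p : ℕ} [Fact p.Prime]

theorem X_mul_derivative_polylogPoly (c : ℕ → ZMod p) :
    X * derivative (polylogPoly p c) = ∑ i ∈ Ioo 0 p, C (c i) * X ^ i := by
  rw [polylogPoly, derivative_sum, mul_sum]
  refine sum_congr rfl fun i hi => ?_
  have h := natCast_ne_zero_of_mem_Ioo hi
  obtain ⟨n, rfl⟩ := Nat.exists_eq_succ_of_ne_zero (mem_Ioo.1 hi).1.ne'
  rw [derivative_C_mul_X_pow, mul_assoc, inv_mul_cancel₀ h, mul_one]
  simp only [Nat.succ_eq_add_one, Nat.add_sub_cancel]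
  ring

theorem sum_Ioo_zero_pow_mul {R : Type*} [CommRing R] (x : R) {j : ℕ} (hj : 0 < j) :
    (x - 1) * ∑ i ∈ Ioo 0 j, x ^ i = x ^ j - x := by
  have h := mul_geom_sum x j
  rw [range_eq_Ico, ← Ioo_insert_left hj, sum_insert (by simp)] at h
  linear_combination h

theorem derivative_polylogPoly_harmonicTail (d : ℕ → ZMod p) (hd : harmonicTail p d 0 = 0) :
    X * (X - 1) * derivative (polylogPoly p (harmonicTail p d)) = polylogPoly p d := by
  rw [mul_comm X, mul_assoc, X_mul_derivative_polylogPoly]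
  have h : ∑ i ∈ Ioo 0 p, C (harmonicTail p d i) * X ^ i =
      ∑ j ∈ Ioo 0 p, C (d j * (j : ZMod p)⁻¹) * ∑ i ∈ Ioo 0 j, X ^ i := by
    simp only [harmonicTail, map_sum, sum_mul, mul_sum]
    refine sum_comm' fun i j => ?_
    simp only [mem_Ioo]
    omega
  have h' : ∑ j ∈ Ioo 0 p, C (d j * (j : ZMod p)⁻¹) * (X : (ZMod p)[X]) = 0 := by
    rw [← sum_mul, ← map_sum]
    change C (harmonicTail p d 0) * X = 0
    simp [hd]
  rw [h, mul_sum, polylogPoly, ← sub_zero (∑ i ∈ Ioo 0 p, C _ * X ^ i), ← h', ← sum_sub_distrib]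
  refine sum_congr rfl fun j hj => ?_
  linear_combination C (d j * (j : ZMod p)⁻¹) *
    sum_Ioo_zero_pow_mul (X : (ZMod p)[X]) (mem_Ioo.1 hj).1

theorem derivative_polylogPoly_one :
    X * (X - 1) * derivative (polylogPoly p fun _ => 1) = X ^ p - X := by
  rw [mul_comm X, mul_assoc, X_mul_derivative_polylogPoly]
  simpa using sum_Ioo_zero_pow_mul (X : (ZMod p)[X]) (Fact.out : p.Prime).pos

theorem eq_C_of_X_mul_derivative_eq_zero {g : (ZMod p)[X]} (hg : g.natDegree < p)
    (h : X * (X - 1) * derivative g = 0) : g = C (g.coeff 0) := by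
  have h0 : derivative g = 0 := by
    refine (mul_eq_zero.1 h).resolve_left (mul_ne_zero X_ne_zero ?_)
    simpa using X_sub_C_ne_zero (1 : ZMod p)
  ext n
  rcases n with _ | n
  · simp
  rw [coeff_C_succ]
  by_cases hn : n + 1 < p
  · have h1 := congrArg (fun f => coeff f n) h0
    simp only [coeff_derivative, coeff_zero] at h1
    refine (mul_eq_zero.1 h1).resolve_right ?_
    exact_mod_cast natCast_ne_zero_of_mem_Ioo (mem_Ioo.2 ⟨n.succ_pos, hn⟩)
  · exact coeff_eq_zero_of_natDegree_lt (by omega)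

theorem natDegree_comp_one_sub_X (f : (ZMod p)[X]) :
    (f.comp (1 - X)).natDegree = f.natDegree := by
  have : (1 - X : (ZMod p)[X]).natDegree = 1 := by
    rw [← neg_sub, natDegree_neg]
    simpa using natDegree_X_sub_C (1 : ZMod p)
  rw [natDegree_comp, this, mul_one]

/-- A polynomial antiderivative for `dx / (x (x - 1))` of a function antisymmetric under
`x ↦ 1 - x` is symmetric. -/
theorem comp_one_sub_X_of_antisymm (hp2 : p ≠ 2) {f e : (ZMod p)[X]} (hf : f.natDegree < p)
    (h : X * (X - 1) * derivative f = e) (he : e.comp (1 - X) = -e) :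
    f.comp (1 - X) = f := by
  have hd : X * (X - 1) * derivative (f - f.comp (1 - X)) = 0 := by
    have h' := congrArg (fun q => comp q (1 - X)) h
    simp only [mul_comp, sub_comp, X_comp, one_comp, he] at h'
    simp only [derivative_sub, derivative_comp, derivative_one, derivative_X]
    linear_combination h + h'
  have hC := eq_C_of_X_mul_derivative_eq_zero ((natDegree_sub_le _ _).trans_lt
    (max_lt hf (by rwa [natDegree_comp_one_sub_X]))) hd
  have h0 := congrArg (eval 0) hC
  have h1 := congrArg (eval 1) hC
  simp only [eval_sub, eval_comp, eval_one, eval_X, sub_self, sub_zero, eval_C] at h0 h1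
  have h2 : (2 : ZMod p) ≠ 0 := by
    intro h
    exact hp2 ((Nat.prime_dvd_prime_iff_eq Fact.out Nat.prime_two).1
      ((ZMod.natCast_eq_zero_iff 2 p).1 (by exact_mod_cast h)))
  have hc : (f - f.comp (1 - X)).coeff 0 = 0 := by
    refine (mul_eq_zero.1 (?_ : (2 : ZMod p) * _ = 0)).resolve_left h2
    linear_combination -h0 - h1
  rw [hc, C_0, sub_eq_zero] at hC
  exact hC.symm

/-- A polynomial antiderivative for `dx / (x (x - 1))` of a function symmetric under
`x ↦ 1 - x` is antisymmetric, provided it vanishes at both `0` and `1`. -/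
theorem comp_one_sub_X_of_symm {f e : (ZMod p)[X]} (hf : f.natDegree < p)
    (h : X * (X - 1) * derivative f = e) (he : e.comp (1 - X) = e)
    (hf0 : f.eval 0 = 0) (hf1 : f.eval 1 = 0) :
    f.comp (1 - X) = -f := by
  have hd : X * (X - 1) * derivative (f + f.comp (1 - X)) = 0 := by
    have h' := congrArg (fun q => comp q (1 - X)) h
    simp only [mul_comp, sub_comp, X_comp, one_comp, he] at h'
    simp only [derivative_add, derivative_sub, derivative_comp, derivative_one, derivative_X]
    linear_combination h - h'
  have hC := eq_C_of_X_mul_derivative_eq_zero ((natDegree_add_le _ _).trans_lt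
    (max_lt hf (by rwa [natDegree_comp_one_sub_X]))) hd
  have h0 := congrArg (eval 0) hC
  simp only [eval_add, eval_comp, eval_sub, eval_one, eval_X, sub_zero, eval_C, hf0, hf1,
    add_zero] at h0
  rw [← h0, C_0] at hC
  linear_combination hC

theorem polylogPoly_one_symm (hp2 : p ≠ 2) :
    (polylogPoly p fun _ => 1).comp (1 - X) = polylogPoly p fun _ => 1 := by
  refine comp_one_sub_X_of_antisymm hp2
    (natDegree_polylogPoly_lt (Fact.out : p.Prime).pos _) derivative_polylogPoly_one ?_
  simp [sub_pow_char]

theorem harmonicTail_one_zero (hp2 : p ≠ 2) : harmonicTail p (fun _ => 1) 0 = 0 := by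
  have h := congrArg (eval 0) (polylogPoly_one_symm (p := p) hp2)
  simpa [eval_comp, eval_one_polylogPoly, eval_zero_polylogPoly] using h

theorem sum_Ioo_inv_sq (hp3 : 3 < p) : ∑ j ∈ Ioo 0 p, ((j : ZMod p)⁻¹) ^ 2 = 0 := by
  have h : ∑ x : ZMod p, x ^ 2 = 0 :=
    FiniteField.sum_pow_lt_card_sub_one _ _ (by rw [ZMod.card]; omega)
  rw [← Equiv.sum_comp (Equiv.inv (ZMod p))] at h
  rw [← h, ← sum_subset (subset_univ (univ.erase (0 : ZMod p)))]
  · refine sum_nbij' (fun j : ℕ => (j : ZMod p)) ZMod.val ?_ ?_ ?_ ?_ ?_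
    · intro j hj
      simpa using natCast_ne_zero_of_mem_Ioo hj
    · intro x hx
      simpa [ZMod.val_lt, Nat.pos_iff_ne_zero] using hx
    · intro j hj
      exact ZMod.val_cast_of_lt (mem_Ioo.1 hj).2
    · intro x _
      simp
    · intro j _
      simp
  · intro x _ hx
    have : x = 0 := by simpa using hx
    simp [this]

theorem sum_Ioo_sq {R : Type*} [CommRing R] (a : ℕ → R) (n : ℕ) :
    (∑ j ∈ Ioo 0 n, a j) ^ 2 =
      2 * ∑ j ∈ Ioo 0 n, (∑ k ∈ Ioo j n, a k) * a j + ∑ j ∈ Ioo 0 n, a j ^ 2 := by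
  have hT : ∑ j ∈ Ioo 0 n, (∑ k ∈ Ioo j n, a k) * a j =
      ∑ j ∈ Ioo 0 n, (∑ k ∈ Ioo 0 j, a k) * a j := by
    simp only [sum_mul]
    rw [sum_comm' (t' := Ioo 0 n) (s' := fun k => Ioo 0 k)]
    · simp only [mul_comm]
    · intro j k
      simp only [mem_Ioo]
      omega
  rw [two_mul]
  nth_rw 1 [hT]
  rw [← sum_add_distrib, ← sum_add_distrib, sq, mul_sum]
  refine sum_congr rfl fun j hj => ?_
  have hj' := mem_Ioo.1 hj
  have : ∑ k ∈ Ioo 0 n, a k = ∑ k ∈ Ioo 0 j, a k + (a j + ∑ k ∈ Ioo j n, a k) := by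
    rw [← sum_insert (by simp), Ioo_insert_left hj'.2, ← sum_union]
    · congr 1
      ext k
      simp only [mem_Ioo, mem_union, mem_Ico]
      omega
    · rw [disjoint_left]
      intro k
      simp only [mem_Ioo, mem_Ico]
      omega
  rw [this]
  ring

theorem harmonicTail_harmonicTail_one_zero (hp3 : 3 < p) :
    harmonicTail p (harmonicTail p fun _ => 1) 0 = 0 := by
  have h2 : (2 : ZMod p) ≠ 0 := by
    exact_mod_cast natCast_ne_zero_of_mem_Ioo (mem_Ioo.2 ⟨two_pos, (by omega : 2 < p)⟩)
  have h := sum_Ioo_sq (fun j => (j : ZMod p)⁻¹) p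
  have h1 := harmonicTail_one_zero (p := p) (by omega)
  simp only [harmonicTail, one_mul] at h1 ⊢
  rw [h1, sum_Ioo_inv_sq hp3] at h
  refine (mul_eq_zero.1 (?_ : (2 : ZMod p) * _ = 0)).resolve_left h2
  linear_combination -h

theorem polylogPoly_harmonicTail_harmonicTail_symm (hp3 : 3 < p) :
    (polylogPoly p (harmonicTail p (harmonicTail p fun _ => 1))).comp (1 - X) =
      polylogPoly p (harmonicTail p (harmonicTail p fun _ => 1)) := by
  have hp0 : 0 < p := by omega
  have hp2 : p ≠ 2 := by omega
  have h2 := harmonicTail_harmonicTail_one_zero (p := p) hp3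
  refine comp_one_sub_X_of_antisymm hp2 (natDegree_polylogPoly_lt hp0 _)
    (derivative_polylogPoly_harmonicTail _ h2) ?_
  refine comp_one_sub_X_of_symm (natDegree_polylogPoly_lt hp0 _)
    (derivative_polylogPoly_harmonicTail _ (harmonicTail_one_zero hp2))
    (polylogPoly_one_symm hp2) (eval_zero_polylogPoly _ _) ?_
  rw [eval_one_polylogPoly, h2]

/-- Powers of a root `w` of `x² - x + 1`, a primitive sixth root of unity when `3` is nonzero. -/
theorem pow_sub_one_sub_pow_of_root {K : Type*} [CommRing K] {w : K} (hw : w ^ 2 - w + 1 = 0)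
    (i : ℕ) : w ^ i - (1 - w) ^ i =
      ((if i % 6 = 1 ∨ i % 6 = 2 then 1 else 0) - (if i % 6 = 4 ∨ i % 6 = 5 then 1 else 0)) *
        (2 * w - 1) := by
  have h3 : w ^ 3 = -1 := by linear_combination (w + 1) * hw
  have h6 : w ^ 6 = 1 := by linear_combination (w ^ 3 - 1) * h3
  have hv : (1 - w) ^ 2 - (1 - w) + 1 = 0 := by linear_combination hw
  have hv3 : (1 - w) ^ 3 = -1 := by linear_combination (1 - w + 1) * hv
  have hv6 : (1 - w) ^ 6 = 1 := by linear_combination ((1 - w) ^ 3 - 1) * hv3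
  rw [pow_eq_pow_mod i h6, pow_eq_pow_mod i hv6]
  have hi : i % 6 < 6 := Nat.mod_lt _ (by norm_num)
  generalize i % 6 = r at hi
  interval_cases r <;> norm_num
  · ring
  · ring
  · rw [h3, hv3, sub_self]
  · linear_combination w * h3 - (1 - w) * hv3
  · linear_combination w ^ 2 * h3 - (1 - w) ^ 2 * hv3

theorem sum_filter_mod_six_eq_of_comp_one_sub_X (hp3 : 3 < p) (c : ℕ → ZMod p)
    (h : (polylogPoly p c).comp (1 - X) = polylogPoly p c) :
    ∑ i ∈ Ioo 0 p with i % 6 = 1 ∨ i % 6 = 2, c i * (i : ZMod p)⁻¹ =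
      ∑ i ∈ Ioo 0 p with i % 6 = 4 ∨ i % 6 = 5, c i * (i : ZMod p)⁻¹ := by
  let K := AlgebraicClosure (ZMod p)
  have hinj : Function.Injective (algebraMap (ZMod p) K) := (algebraMap (ZMod p) K).injective
  have h3 : (3 : K) ≠ 0 := by
    have : ((3 : ℕ) : ZMod p) ≠ 0 := natCast_ne_zero_of_mem_Ioo (mem_Ioo.2 ⟨three_pos, hp3⟩)
    rwa [← map_ne_zero_iff _ hinj, map_natCast, Nat.cast_ofNat] at this
  obtain ⟨w, hw⟩ : ∃ w : K, w ^ 2 - w + 1 = 0 := by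
    obtain ⟨w, hw⟩ := IsAlgClosed.exists_root (X ^ 2 - X + 1 : K[X])
      (by rw [show (X ^ 2 - X + 1 : K[X]).degree = 2 by compute_degree!]; norm_num)
    exact ⟨w, by simpa [IsRoot] using hw⟩
  have hw1 : 2 * w - 1 ≠ 0 := fun h0 => h3 (by linear_combination 4 * hw - (2 * w - 1) * h0)
  have hs : aeval w (polylogPoly p c) - aeval (1 - w) (polylogPoly p c) = 0 := by
    nth_rw 1 [← h]
    simp [aeval_comp]
  simp only [polylogPoly, map_sum, map_mul, aeval_C, map_pow, aeval_X] at hs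
  rw [← sum_sub_distrib] at hs
  simp only [← mul_sub, pow_sub_one_sub_pow_of_root hw] at hs
  simp only [← mul_assoc] at hs
  rw [← sum_mul] at hs
  have hz := (mul_eq_zero.1 hs).resolve_right hw1
  simp only [mul_sub, sum_sub_distrib, mul_ite, mul_one, mul_zero, ← sum_filter] at hz
  apply hinj
  simp only [map_sum, map_mul]
  exact sub_eq_zero.1 hz

theorem sum_triple_inv_eq (i : ℕ) :
    ∑ j ∈ Ioo i p, ∑ k ∈ Ioo j p, (i : ZMod p)⁻¹ * (j : ZMod p)⁻¹ * (k : ZMod p)⁻¹ =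
      harmonicTail p (harmonicTail p fun _ => 1) i * (i : ZMod p)⁻¹ := by
  simp only [harmonicTail, sum_mul, one_mul]
  refine sum_congr rfl fun j _ => sum_congr rfl fun k _ => ?_
  ring

end

/-- Let `p > 3` be a prime. Then
`∑_{0<i<j<k<p, i ≡ 1,2 (mod 6)} 1/(ijk) = ∑_{0<i<j<k<p, i ≡ 4,5 (mod 6)} 1/(ijk)` in `ℤ/pℤ`. -/
theorem curious_congruence_triple_six (p : ℕ) (hp : p.Prime) (hp3 : 3 < p) :
    ∑ i ∈ (Finset.Ioo 0 p).filter (fun i => i % 6 = 1 ∨ i % 6 = 2),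
      ∑ j ∈ Finset.Ioo i p, ∑ k ∈ Finset.Ioo j p,
        (i : ZMod p)⁻¹ * (j : ZMod p)⁻¹ * (k : ZMod p)⁻¹ =
    ∑ i ∈ (Finset.Ioo 0 p).filter (fun i => i % 6 = 4 ∨ i % 6 = 5),
      ∑ j ∈ Finset.Ioo i p, ∑ k ∈ Finset.Ioo j p,
        (i : ZMod p)⁻¹ * (j : ZMod p)⁻¹ * (k : ZMod p)⁻¹ := by
  have : Fact p.Prime := ⟨hp⟩
  simp only [sum_triple_inv_eq]
  exact sum_filter_mod_six_eq_of_comp_one_sub_X hp3 _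
    (polylogPoly_harmonicTail_harmonicTail_symm hp3)
end

section
/- Let n be a positive odd integer and let p > n + 1 be a prime. Then the sum over all n-tuples of integers 0 < i_1 < i_2 < ⋯ < i_n < p of (i_1/3)·(-1)^{i_1}/(i_1 ⋯ i_n), computed in ℤ/pℤ, is congruent to 0 modulo p. -/
/-- Strictly increasing `n`-tuples of integers in the open interval `(m, p)`. -/
def increasingTuples (p n m : ℕ) : Finset (Fin n → ℕ) :=
  (Fintype.piFinset fun _ : Fin n => Finset.Ioo m p).filter
    (fun f => ∀ i j : Fin n, i < j → f i < f j)

theorem sum_increasingTuples_succ {M : Type*} [AddCommMonoid M] (p n m : ℕ)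
    (g : (Fin (n + 1) → ℕ) → M) :
    ∑ f ∈ increasingTuples p (n + 1) m, g f =
      ∑ i ∈ Finset.Ioo m p, ∑ f ∈ increasingTuples p n i, g (Fin.cons i f) := by
  rw [Finset.sum_sigma']
  refine Finset.sum_bij' (fun f _ => ⟨f 0, Fin.tail f⟩) (fun x _ => Fin.cons x.1 x.2)
    ?_ ?_ ?_ ?_ ?_
  · intro f hf
    simp only [increasingTuples, Finset.mem_filter, Fintype.mem_piFinset, Finset.mem_Ioo,
      Finset.mem_sigma, Fin.tail] at hf ⊢
    exact ⟨hf.1 0, fun a => ⟨hf.2 _ _ (Fin.succ_pos a), (hf.1 _).2⟩,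
      fun i j hij => hf.2 _ _ (Fin.succ_lt_succ_iff.2 hij)⟩
  · rintro ⟨i, f⟩ hf
    simp only [increasingTuples, Finset.mem_filter, Fintype.mem_piFinset, Finset.mem_Ioo,
      Finset.mem_sigma] at hf ⊢
    obtain ⟨hi, hf, hmono⟩ := hf
    refine ⟨Fin.cases ?_ ?_, Fin.cases ?_ ?_⟩
    · simpa using hi
    · intro a
      simpa using ⟨hi.1.trans (hf a).1, (hf a).2⟩
    · refine Fin.cases ?_ ?_
      · simp
      · intro j _
        simpa using (hf j).1
    · intro a
      refine Fin.cases ?_ ?_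
      · simp
      · intro b hab
        simpa using hmono a b (Fin.succ_lt_succ_iff.1 hab)
  · intro f _
    simp
  · rintro ⟨i, f⟩ _
    simp
  · intro f _
    simp

/-- The multiple harmonic sum `∑ 1 / (i₁ ⋯ iₙ)` over `m < i₁ < ⋯ < iₙ < p`, modulo `p`. -/
def multipleHarmonic (p n m : ℕ) : ZMod p :=
  ∑ f ∈ increasingTuples p n m, ∏ k, ((f k : ZMod p))⁻¹

theorem sum_increasingTuples_mul_prod_inv (p n m : ℕ) (w : ℕ → ZMod p) :
    ∑ f ∈ increasingTuples p (n + 1) m, w (f 0) * ∏ k, ((f k : ZMod p))⁻¹ =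
      ∑ i ∈ Finset.Ioo m p, w i * ((i : ZMod p)⁻¹ * multipleHarmonic p n i) := by
  simp only [sum_increasingTuples_succ, multipleHarmonic, Fin.prod_univ_succ, Fin.cons_zero,
    Fin.cons_succ, Finset.mul_sum]

theorem multipleHarmonic_zero (p m : ℕ) : multipleHarmonic p 0 m = 1 := by
  simp [multipleHarmonic, increasingTuples]

theorem multipleHarmonic_succ (p n m : ℕ) :
    multipleHarmonic p (n + 1) m =
      ∑ i ∈ Finset.Ioo m p, (i : ZMod p)⁻¹ * multipleHarmonic p n i := by
  simpa [multipleHarmonic] using sum_increasingTuples_mul_prod_inv p n m fun _ => 1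

section Polynomial

open Polynomial

theorem coeff_prod_one_add_inv_mul_X (p d : ℕ) :
    ∀ n m, m + d + 1 = p →
      (∏ j ∈ Finset.Ioo m p, (1 + C ((j : ZMod p)⁻¹) * X)).coeff n = multipleHarmonic p n m := by
  induction d with
  | zero =>
    intro n m h
    have he : Finset.Ioo m p = ∅ := by ext; simp; omega
    cases n with
    | zero => simp [multipleHarmonic_zero, he]
    | succ n => simp [multipleHarmonic_succ, he, coeff_one]
  | succ d ih =>
    intro n m h
    have he : Finset.Ioo m p = insert (m + 1) (Finset.Ioo (m + 1) p) := by
      ext; simp; omega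
    have hne : m + 1 ∉ Finset.Ioo (m + 1) p := by simp
    rw [he, Finset.prod_insert hne, add_mul, one_mul, coeff_add, ih n (m + 1) (by omega),
      mul_assoc, coeff_C_mul]
    cases n with
    | zero => simp [multipleHarmonic_zero]
    | succ n =>
      rw [coeff_X_mul, ih n (m + 1) (by omega), multipleHarmonic_succ p n m, he,
        Finset.sum_insert hne, ← multipleHarmonic_succ, add_comm]

variable {p : ℕ} [Fact p.Prime]

theorem prod_one_add_inv_mul_X :
    ∏ j ∈ Finset.Ioo 0 p, (1 + C ((j : ZMod p)⁻¹) * X) = 1 - (X : (ZMod p)[X]) ^ (p - 1) := by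
  have hp := Fact.out (p := p.Prime)
  rw [← sub_eq_zero]
  refine eq_zero_of_natDegree_lt_card_of_eval_eq_zero _ Function.injective_id (fun a => ?_) ?_
  · rw [eval_sub, eval_prod]
    by_cases ha : a = 0
    · simp [ha, (Nat.sub_pos_of_lt hp.one_lt).ne']
    · have hv : (-a).val ∈ Finset.Ioo 0 p := by
        simp [ZMod.val_lt, Nat.pos_iff_ne_zero, ha]
      rw [Finset.prod_eq_zero hv]
      · simp [ZMod.pow_card_sub_one_eq_one ha]
      · simp [inv_neg, ha]
  · rw [ZMod.card]
    have hlt : p - 1 < p := Nat.sub_lt hp.pos one_pos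
    refine lt_of_le_of_lt (natDegree_sub_le_of_le (m := p - 1) (n := p - 1) ?_ ?_) (by simpa using hp.pos)
    · refine (natDegree_prod_le _ _).trans ?_
      refine (Finset.sum_le_card_nsmul _ _ 1 fun j _ => ?_).trans (by simp)
      compute_degree
    · compute_degree

theorem multipleHarmonic_eq_zero {n : ℕ} (hn : n ≠ 0) (hnp : n + 1 < p) :
    multipleHarmonic p n 0 = 0 := by
  have hp := Fact.out (p := p.Prime)
  rw [← coeff_prod_one_add_inv_mul_X p (p - 1) n 0 (by omega), prod_one_add_inv_mul_X]
  simp [coeff_one, coeff_X_pow, hn]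
  omega

/-- The polynomial `∑ x ^ i₁ / (i₁ ⋯ iₙ₊₁)` over `0 < i₁ < ⋯ < iₙ₊₁ < p`, modulo `p`. -/
noncomputable def truncatedPolylog (p n : ℕ) : (ZMod p)[X] :=
  ∑ i ∈ Finset.Ioo 0 p, C ((i : ZMod p)⁻¹ * multipleHarmonic p n i) * X ^ i

theorem eval_zero_truncatedPolylog (p n : ℕ) : (truncatedPolylog p n).eval 0 = 0 := by
  rw [truncatedPolylog, eval_finsetSum]
  refine Finset.sum_eq_zero fun i hi => ?_
  have : i ≠ 0 := by simp at hi; omega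
  simp [this]

theorem eval_one_truncatedPolylog (p n : ℕ) :
    (truncatedPolylog p n).eval 1 = multipleHarmonic p (n + 1) 0 := by
  simp [truncatedPolylog, eval_finsetSum, multipleHarmonic_succ]

theorem natDegree_truncatedPolylog_lt (n : ℕ) : (truncatedPolylog p n).natDegree < p := by
  have hp := Fact.out (p := p.Prime)
  refine lt_of_le_of_lt (natDegree_sum_le_of_forall_le (n := p - 1) _ _ fun i hi => ?_)
    (Nat.sub_lt hp.pos one_pos)
  refine (natDegree_C_mul_X_pow_le _ _).trans ?_
  simp at hi
  omega

theorem aeval_truncatedPolylog {A : Type*} [Ring A] [Algebra (ZMod p) A] (n : ℕ) (a : A) :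
    aeval a (truncatedPolylog p n) =
      ∑ i ∈ Finset.Ioo 0 p, ((i : ZMod p)⁻¹ * multipleHarmonic p n i) • a ^ i := by
  simp only [truncatedPolylog, map_sum, C_mul_X_pow_eq_monomial, aeval_monomial,
    Algebra.smul_def]

theorem X_mul_derivative_truncatedPolylog (n : ℕ) :
    X * derivative (truncatedPolylog p n) =
      ∑ i ∈ Finset.Ioo 0 p, C (multipleHarmonic p n i) * X ^ i := by
  rw [truncatedPolylog, derivative_sum, Finset.mul_sum]
  refine Finset.sum_congr rfl fun i hi => ?_
  rw [Finset.mem_Ioo] at hi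
  have h0 : (i : ZMod p) ≠ 0 := by
    rw [Ne, ZMod.natCast_eq_zero_iff]
    exact Nat.not_dvd_of_pos_of_lt hi.1 hi.2
  have hi' : i = i - 1 + 1 := by omega
  rw [derivative_C_mul_X_pow, mul_right_comm _ _ (i : ZMod p), inv_mul_cancel₀ h0, one_mul]
  nth_rw 4 [hi']
  rw [pow_succ]
  ring

theorem one_sub_X_mul_sum_Ioo (R : Type*) [CommRing R] {j : ℕ} (hj : 0 < j) :
    (1 - X) * ∑ i ∈ Finset.Ioo 0 j, (X : R[X]) ^ i = X - X ^ j := by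
  induction j, hj using Nat.le_induction with
  | base =>
    have he : Finset.Ioo 0 1 = ∅ := by ext; simp; omega
    simp [he]
  | succ j hj ih =>
    have he : Finset.Ioo 0 (j + 1) = insert j (Finset.Ioo 0 j) := by
      ext; simp; omega
    rw [he, Finset.sum_insert (by simp), mul_add, ih]
    ring

theorem derivative_truncatedPolylog_zero :
    X * (1 - X) * derivative (truncatedPolylog p 0) = X - X ^ p := by
  have hp := Fact.out (p := p.Prime)
  rw [mul_comm X, mul_assoc, X_mul_derivative_truncatedPolylog]
  simp only [multipleHarmonic_zero, map_one, one_mul]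
  exact one_sub_X_mul_sum_Ioo _ hp.pos

theorem derivative_truncatedPolylog_succ {n : ℕ} (hn : n + 2 < p) :
    X * (1 - X) * derivative (truncatedPolylog p (n + 1)) = -truncatedPolylog p n := by
  have key : ∑ i ∈ Finset.Ioo 0 p, C (multipleHarmonic p (n + 1) i) * X ^ i =
      ∑ j ∈ Finset.Ioo 0 p, C ((j : ZMod p)⁻¹ * multipleHarmonic p n j) *
        ∑ i ∈ Finset.Ioo 0 j, X ^ i := by
    simp only [multipleHarmonic_succ, map_sum, Finset.sum_mul, Finset.mul_sum]
    refine Finset.sum_comm' fun i j => ?_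
    simp
    omega
  rw [mul_comm X, mul_assoc, X_mul_derivative_truncatedPolylog, key, Finset.mul_sum]
  have h : ∀ j ∈ Finset.Ioo 0 p, (1 - X) * (C ((j : ZMod p)⁻¹ * multipleHarmonic p n j) *
        ∑ i ∈ Finset.Ioo 0 j, X ^ i) =
      C ((j : ZMod p)⁻¹ * multipleHarmonic p n j) * X -
        C ((j : ZMod p)⁻¹ * multipleHarmonic p n j) * X ^ j := fun j hj => by
    rw [mul_left_comm, one_sub_X_mul_sum_Ioo _ (Finset.mem_Ioo.1 hj).1, mul_sub]
  rw [Finset.sum_congr rfl h, Finset.sum_sub_distrib, ← Finset.sum_mul, ← map_sum,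
    ← multipleHarmonic_succ, multipleHarmonic_eq_zero n.succ_ne_zero (by omega)]
  simp [truncatedPolylog]

theorem eq_C_eval_zero_of_derivative_eq_zero {f : (ZMod p)[X]} (hf : f.natDegree < p)
    (h : derivative f = 0) : f = C (f.eval 0) := by
  ext k
  rw [coeff_C]
  split_ifs with hk
  · rw [hk, coeff_zero_eq_eval_zero]
  · obtain ⟨k, rfl⟩ := Nat.exists_eq_succ_of_ne_zero hk
    by_cases hkp : k + 1 < p
    · have := congrArg (fun g => g.coeff k) h
      simp only [coeff_derivative, coeff_zero, mul_eq_zero] at this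
      refine this.resolve_right fun h0 => ?_
      rw [← Nat.cast_succ, ZMod.natCast_eq_zero_iff] at h0
      exact Nat.not_dvd_of_pos_of_lt k.succ_pos hkp h0
    · exact coeff_eq_zero_of_natDegree_lt (by simp; omega)

theorem truncatedPolylog_comp_one_sub_X {n : ℕ} (hn : n + 2 < p) :
    (truncatedPolylog p n).comp (1 - X) = (-1) ^ n * truncatedPolylog p n := by
  have hne : (X : (ZMod p)[X]) * (1 - X) ≠ 0 := by
    refine mul_ne_zero X_ne_zero fun h => ?_
    simpa using congrArg (eval 0) h
  have hsymm : ∀ f : (ZMod p)[X], X * (1 - X) * derivative (f.comp (1 - X)) =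
      -(X * (1 - X) * derivative f).comp (1 - X) := fun f => by
    simp only [derivative_comp, mul_comp, sub_comp, one_comp, X_comp, derivative_sub,
      derivative_one, derivative_X]
    ring
  suffices h : derivative ((truncatedPolylog p n).comp (1 - X) -
      (-1) ^ n * truncatedPolylog p n) = 0 by
    have hC : ((-1) ^ n : (ZMod p)[X]) = C ((-1) ^ n) := by simp
    have hdeg : ((truncatedPolylog p n).comp (1 - X) -
        (-1) ^ n * truncatedPolylog p n).natDegree < p := by
      refine lt_of_le_of_lt (natDegree_sub_le_of_le (m := (truncatedPolylog p n).natDegree)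
        (n := (truncatedPolylog p n).natDegree) ?_ ?_) (by
          simpa using natDegree_truncatedPolylog_lt n)
      · refine natDegree_comp_le.trans ?_
        have : (1 - X : (ZMod p)[X]).natDegree ≤ 1 := by compute_degree
        simpa using Nat.mul_le_mul_left (truncatedPolylog p n).natDegree this
      · rw [hC]
        exact natDegree_C_mul_le _ _
    rw [← sub_eq_zero, eq_C_eval_zero_of_derivative_eq_zero hdeg h]
    simp [eval_comp, eval_zero_truncatedPolylog, eval_one_truncatedPolylog,
      multipleHarmonic_eq_zero n.succ_ne_zero hn]
  refine (mul_eq_zero.1 ?_).resolve_left hne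
  have hC : ((-1) ^ n : (ZMod p)[X]) = C ((-1) ^ n) := by simp
  rw [derivative_sub, mul_sub, hsymm, hC, derivative_C_mul, mul_left_comm]
  cases n with
  | zero =>
    rw [derivative_truncatedPolylog_zero]
    simp [sub_pow_char]
  | succ n =>
    rw [derivative_truncatedPolylog_succ (by omega), neg_comp, neg_neg,
      truncatedPolylog_comp_one_sub_X (by omega)]
    simp [pow_succ]

end Polynomial

section SixthRoot

variable (R : Type*) [CommRing R]

/-- A root of `X ^ 2 - X + 1`, i.e. a matrix model of a primitive sixth root of unity. -/
def sixthRootMatrix : Matrix (Fin 2) (Fin 2) R := !![0, -1; 1, 1]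

/-- The value `(i/3) (-1) ^ i`. -/
def signedLegendreThree (i : ℕ) : R :=
  (if i % 3 = 1 then 1 else if i % 3 = 2 then -1 else 0) * (-1) ^ i

theorem signedLegendreThree_add_three (i : ℕ) :
    signedLegendreThree R (i + 3) = -signedLegendreThree R i := by
  simp [signedLegendreThree, pow_succ]

theorem sixthRootMatrix_pow_three : sixthRootMatrix R ^ 3 = -1 := by
  ext i j
  fin_cases i <;> fin_cases j <;> simp [sixthRootMatrix, pow_succ]

theorem one_sub_sixthRootMatrix_pow_three : (1 - sixthRootMatrix R) ^ 3 = -1 := by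
  ext i j
  fin_cases i <;> fin_cases j <;>
    simp [sixthRootMatrix, pow_succ, Matrix.one_fin_two]

theorem sixthRootMatrix_pow_apply (i : ℕ) :
    (sixthRootMatrix R ^ i) 1 0 = -signedLegendreThree R i := by
  induction i using Nat.strong_induction_on with
  | _ i ih =>
    match i with
    | 0 => simp [signedLegendreThree]
    | 1 => simp [signedLegendreThree, sixthRootMatrix]
    | 2 => simp [signedLegendreThree, sixthRootMatrix, pow_two]
    | i + 3 =>
      rw [pow_add, sixthRootMatrix_pow_three, signedLegendreThree_add_three, ← ih i (by omega)]
      simp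

theorem one_sub_sixthRootMatrix_pow_apply (i : ℕ) :
    ((1 - sixthRootMatrix R) ^ i) 1 0 = signedLegendreThree R i := by
  induction i using Nat.strong_induction_on with
  | _ i ih =>
    match i with
    | 0 => simp [signedLegendreThree]
    | 1 => simp [signedLegendreThree, sixthRootMatrix]
    | 2 => simp [signedLegendreThree, sixthRootMatrix, pow_two, Matrix.one_fin_two]
    | i + 3 =>
      rw [pow_add, one_sub_sixthRootMatrix_pow_three, signedLegendreThree_add_three,
        ← ih i (by omega)]
      simp

end SixthRoot

/-- Let `n` be a positive odd integer and `p > n + 1` a prime. Then the sum over all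
strictly increasing `n`-tuples `0 < i₁ < ⋯ < iₙ < p` of `(i₁/3)·(-1)^{i₁}/(i₁⋯iₙ)`,
computed in `ℤ/pℤ`, is `0`. Here `(i/3)` is `1` if `i ≡ 1 (mod 3)`, `-1` if
`i ≡ 2 (mod 3)` and `0` if `3 ∣ i`. -/
theorem curious_congruence_odd (n p : ℕ) (hn : 0 < n) (hodd : Odd n)
    (hp : p.Prime) (hnp : n + 1 < p) :
    ∑ f ∈ (Fintype.piFinset fun _ : Fin n => Finset.Ioo 0 p).filter
        (fun f => ∀ i j : Fin n, i < j → f i < f j),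
      (if f ⟨0, hn⟩ % 3 = 1 then (1 : ZMod p)
        else if f ⟨0, hn⟩ % 3 = 2 then -1 else 0) *
        (-1) ^ (f ⟨0, hn⟩) * ∏ k : Fin n, ((f k : ZMod p))⁻¹ = 0 := by
  have : Fact p.Prime := ⟨hp⟩
  obtain ⟨n, rfl⟩ := Nat.exists_eq_succ_of_ne_zero hn.ne'
  have heven : Even n := by simpa [Nat.odd_add_one] using hodd
  refine (sum_increasingTuples_mul_prod_inv p n 0 (signedLegendreThree (ZMod p))).trans ?_
  have h := congrArg (fun F => Polynomial.aeval (sixthRootMatrix (ZMod p)) F 1 0)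
    (truncatedPolylog_comp_one_sub_X (p := p) (n := n) hnp)
  simp only [heven.neg_one_pow, one_mul, Polynomial.aeval_comp, aeval_truncatedPolylog,
    map_sub, map_one, Polynomial.aeval_X, Matrix.sum_apply, Matrix.smul_apply, smul_eq_mul,
    sixthRootMatrix_pow_apply, one_sub_sixthRootMatrix_pow_apply, mul_neg,
    Finset.sum_neg_distrib] at h
  simp only [mul_comm (signedLegendreThree (ZMod p) _)]
  have : Fact (2 < p) := ⟨by omega⟩
  exact (ZMod.neg_eq_self_iff _).1 h.symm |>.resolve_right fun h2 => by
    have := hp.eq_two_or_odd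
    omega
end
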